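/- For the transformed Fermat cubic F(z) = z₁z₄² + z₄z₁² + z₂z₃² + z₃z₂², the five lines Lₖ joining the point pₖ on the line {z₃ = z₄ = 0} to τ(pₖ), where p₁,…,p₅ correspond to the points 0, 1, ω, ω², ∞ in an inhomogeneous coordinate on that line, are τ-invariant lines; in particular the line {z₁ = z₂ = 0} (joining [0,0,1,0] and [0,0,0,1] = τ-image considerations) satisfies τ({z₁=z₂=0}) = {z₁=z₂=0}, and F vanishes identically on {z₁ = z₂ = 0}. -/

import Mathlib

/-- The antiholomorphic map τ on ℂ⁴ induced by left multiplication by the quaternion j. -/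
noncomputable def tau (z : Fin 4 → ℂ) : Fin 4 → ℂ :=
  ![-(starRingEnd ℂ (z 1)), starRingEnd ℂ (z 0), -(starRingEnd ℂ (z 3)), starRingEnd ℂ (z 2)]

/-- The transformed Fermat cubic F(z) = z₁z₄² + z₄z₁² + z₂z₃² + z₃z₂². -/
def F (z : Fin 4 → ℂ) : ℂ :=
  z 0 * (z 3) ^ 2 + z 3 * (z 0) ^ 2 + z 1 * (z 2) ^ 2 + z 2 * (z 1) ^ 2

theorem tau_add (z w : Fin 4 → ℂ) : tau (z + w) = tau z + tau w := by
  ext i; fin_cases i <;> simp [tau] <;> ring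

theorem tau_smul (a : ℂ) (z : Fin 4 → ℂ) : tau (a • z) = starRingEnd ℂ a • tau z := by
  ext i; fin_cases i <;> simp [tau]

theorem tau_tau (z : Fin 4 → ℂ) : tau (tau z) = -z := by
  ext i; fin_cases i <;> simp [tau]

theorem tau_image_eq_of_mapsTo {s : Set (Fin 4 → ℂ)} (hs : Set.MapsTo tau s s)
    (hneg : ∀ v ∈ s, -v ∈ s) : tau '' s = s := by
  refine hs.image_subset.antisymm fun v hv => ⟨tau (-v), hs (hneg v hv), ?_⟩
  rw [tau_tau, neg_neg]

theorem mapsTo_tau_span_pair (p : Fin 4 → ℂ) :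
    Set.MapsTo tau (Submodule.span ℂ {p, tau p} : Submodule ℂ (Fin 4 → ℂ))
      (Submodule.span ℂ {p, tau p} : Submodule ℂ (Fin 4 → ℂ)) := by
  intro v hv
  obtain ⟨a, b, rfl⟩ := Submodule.mem_span_pair.1 hv
  refine Submodule.mem_span_pair.2 ⟨-starRingEnd ℂ b, starRingEnd ℂ a, ?_⟩
  rw [tau_add, tau_smul, tau_smul, tau_tau, smul_neg, neg_smul, add_comm]

/-- The lines joining a point p to τ(p) are τ-invariant; in particular the line
{z₁ = z₂ = 0} satisfies τ({z₁ = z₂ = 0}) = {z₁ = z₂ = 0}, and F vanishes identically on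
{z₁ = z₂ = 0}, so it is a twistor line of the transformed Fermat cubic. -/
theorem twistor_lines_of_transformed_fermat :
    (∀ p : Fin 4 → ℂ, p ≠ 0 →
      tau '' ((Submodule.span ℂ {p, tau p} : Submodule ℂ (Fin 4 → ℂ)) : Set (Fin 4 → ℂ)) =
        ↑(Submodule.span ℂ {p, tau p} : Submodule ℂ (Fin 4 → ℂ))) ∧
    tau '' {v : Fin 4 → ℂ | v 0 = 0 ∧ v 1 = 0} = {v : Fin 4 → ℂ | v 0 = 0 ∧ v 1 = 0} ∧
    (∀ v : Fin 4 → ℂ, v 0 = 0 → v 1 = 0 → F v = 0) := by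
  refine ⟨fun p _ => tau_image_eq_of_mapsTo (mapsTo_tau_span_pair p)
    fun v hv => Submodule.neg_mem _ hv, tau_image_eq_of_mapsTo ?_ ?_, ?_⟩
  · rintro v ⟨h0, h1⟩
    simp [tau, h0, h1]
  · rintro v ⟨h0, h1⟩
    simp [h0, h1]
  · intro v h0 h1
    simp [F, h0, h1]
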